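/- arXiv:1305.4288 — 4 statements merged into one kernel-verified Lean document; each statement's English description precedes it below -/
import Mathlib

section
/- Let D be a collection of upwards closed, first-order definable dependencies. Then for every FO(D)-formula φ(x̄) with free variables among x̄ there exists a first-order sentence φ*(R) over the signature expanded by a new |x̄|-ary relation symbol R, such that for all models M and teams X: M ⊨_X φ(x̄) iff (M, X(x̄)) ⊨ φ*(R). In particular, every sentence of FO(D) is equivalent to a first-order sentence. -/
/-- Formulas of first-order logic with team semantics, in negation normal form,
over a relational signature `σ` (with arities `ar`) extended with dependency
atoms indexed by `δ` (with arities `dar`).  Equality and inequality literals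
are between tuples of variables; variables are natural numbers. -/
inductive TForm (σ : Type) (ar : σ → ℕ) (δ : Type) (dar : δ → ℕ) : Type
  | rel (r : σ) (ts : Fin (ar r) → ℕ)
  | nrel (r : σ) (ts : Fin (ar r) → ℕ)
  | eq (k : ℕ) (x y : Fin k → ℕ)
  | neq (k : ℕ) (x y : Fin k → ℕ)
  | dep (d : δ) (xs : Fin (dar d) → ℕ)
  | and (φ ψ : TForm σ ar δ dar)
  | or (φ ψ : TForm σ ar δ dar)
  | ex (v : ℕ) (φ : TForm σ ar δ dar)
  | all (v : ℕ) (φ : TForm σ ar δ dar)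

/-- A team over a model with carrier `M`: a set of assignments. -/
abbrev Team (M : Type) := Set (ℕ → M)

/-- `X(x̄)`: the relation of values of the tuple `x̄` in the team `X`. -/
def Team.rel {M : Type} (X : Team M) {k : ℕ} (xs : Fin k → ℕ) : Set (Fin k → M) :=
  {t | ∃ s ∈ X, t = fun i => s (xs i)}

/-- An interpretation of a family of dependencies: for each index, an
isomorphism-invariant-style class of pairs (carrier, relation). -/
abbrev DepFam (δ : Type) (dar : δ → ℕ) := ∀ d : δ, ∀ M : Type, Set (Fin (dar d) → M) → Prop

/-- Lax team semantics. -/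
def tsat {σ : Type} {ar : σ → ℕ} {δ : Type} {dar : δ → ℕ} {M : Type}
    (RI : ∀ r : σ, Set (Fin (ar r) → M)) (DI : DepFam δ dar) :
    TForm σ ar δ dar → Team M → Prop
  | .rel r ts, X => ∀ s ∈ X, (fun i => s (ts i)) ∈ RI r
  | .nrel r ts, X => ∀ s ∈ X, (fun i => s (ts i)) ∉ RI r
  | .eq _ x y, X => ∀ s ∈ X, (fun i => s (x i)) = fun i => s (y i)
  | .neq _ x y, X => ∀ s ∈ X, (fun i => s (x i)) ≠ fun i => s (y i)
  | .dep d xs, X => DI d M (X.rel xs)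
  | .and φ ψ, X => tsat RI DI φ X ∧ tsat RI DI ψ X
  | .or φ ψ, X => ∃ Y Z, X = Y ∪ Z ∧ tsat RI DI φ Y ∧ tsat RI DI ψ Z
  | .ex v φ, X => ∃ H : (ℕ → M) → Set M, (∀ s ∈ X, (H s).Nonempty) ∧
      tsat RI DI φ {s' | ∃ s ∈ X, ∃ m ∈ H s, s' = Function.update s v m}
  | .all v φ, X => tsat RI DI φ {s' | ∃ s ∈ X, ∃ m : M, s' = Function.update s v m}

/-- Tarski (single-assignment) semantics; dependency atoms are treated as
trivially true (they are only meaningful for first-order formulas). -/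
def ssat {σ : Type} {ar : σ → ℕ} {δ : Type} {dar : δ → ℕ} {M : Type}
    (RI : ∀ r : σ, Set (Fin (ar r) → M)) :
    TForm σ ar δ dar → (ℕ → M) → Prop
  | .rel r ts, s => (fun i => s (ts i)) ∈ RI r
  | .nrel r ts, s => (fun i => s (ts i)) ∉ RI r
  | .eq _ x y, s => (fun i => s (x i)) = fun i => s (y i)
  | .neq _ x y, s => (fun i => s (x i)) ≠ fun i => s (y i)
  | .dep _ _, _ => True
  | .and φ ψ, s => ssat RI φ s ∧ ssat RI ψ s
  | .or φ ψ, s => ssat RI φ s ∨ ssat RI ψ s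
  | .ex v φ, s => ∃ m : M, ssat RI φ (Function.update s v m)
  | .all v φ, s => ∀ m : M, ssat RI φ (Function.update s v m)

/-- A formula is first-order if it contains no dependency atoms. -/
def TForm.isFO {σ : Type} {ar : σ → ℕ} {δ : Type} {dar : δ → ℕ} :
    TForm σ ar δ dar → Prop
  | .dep _ _ => False
  | .and φ ψ => φ.isFO ∧ ψ.isFO
  | .or φ ψ => φ.isFO ∧ ψ.isFO
  | .ex _ φ => φ.isFO
  | .all _ φ => φ.isFO
  | _ => True

/-- Free variables of a formula. -/
def TForm.free {σ : Type} {ar : σ → ℕ} {δ : Type} {dar : δ → ℕ} :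
    TForm σ ar δ dar → Set ℕ
  | .rel _ ts => Set.range ts
  | .nrel _ ts => Set.range ts
  | .eq _ x y => Set.range x ∪ Set.range y
  | .neq _ x y => Set.range x ∪ Set.range y
  | .dep _ xs => Set.range xs
  | .and φ ψ => φ.free ∪ ψ.free
  | .or φ ψ => φ.free ∪ ψ.free
  | .ex v φ => φ.free \ {v}
  | .all v φ => φ.free \ {v}

/-- The flattening `φᶠ`: replace every dependency atom by the trivially true
atom `⊤` (here rendered as the empty-tuple equality). -/
def TForm.flatten {σ : Type} {ar : σ → ℕ} {δ : Type} {dar : δ → ℕ} :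
    TForm σ ar δ dar → TForm σ ar δ dar
  | .dep _ _ => .eq 0 Fin.elim0 Fin.elim0
  | .and φ ψ => .and φ.flatten ψ.flatten
  | .or φ ψ => .or φ.flatten ψ.flatten
  | .ex v φ => .ex v φ.flatten
  | .all v φ => .all v φ.flatten
  | φ => φ

/-- Negation normal form of the negation of a (first-order) formula. -/
def TForm.neg {σ : Type} {ar : σ → ℕ} {δ : Type} {dar : δ → ℕ} :
    TForm σ ar δ dar → TForm σ ar δ dar
  | .rel r ts => .nrel r ts
  | .nrel r ts => .rel r ts
  | .eq k x y => .neq k x y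
  | .neq k x y => .eq k x y
  | .dep d xs => .dep d xs
  | .and φ ψ => .or φ.neg ψ.neg
  | .or φ ψ => .and φ.neg ψ.neg
  | .ex v φ => .all v φ.neg
  | .all v φ => .ex v φ.neg

/-- `(ψ ↾ θ) := (¬θ) ∨ (θ ∧ ψ)`. -/
def TForm.restrict {σ : Type} {ar : σ → ℕ} {δ : Type} {dar : δ → ℕ}
    (ψ θ : TForm σ ar δ dar) : TForm σ ar δ dar :=
  .or θ.neg (.and θ ψ)

/-- A family of dependencies is upwards closed. -/
def UpClosed {δ : Type} {dar : δ → ℕ} (DI : DepFam δ dar) : Prop :=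
  ∀ (d : δ) (M : Type) (R S : Set (Fin (dar d) → M)), R ⊆ S → DI d M R → DI d M S

/-- The constancy dependency of arity `n`. -/
def ConstD (n : ℕ) : ∀ M : Type, Set (Fin n → M) → Prop :=
  fun _ R => ∀ t ∈ R, ∀ t' ∈ R, t = t'

/-- A dependency of arity `n` is first-order definable: there is a first-order
sentence `D*(R)` over the signature `{R}` (with `R` of arity `n`) defining it. -/
def FODefinable (n : ℕ) (D : ∀ M : Type, Set (Fin n → M) → Prop) : Prop :=
  ∃ ψ : TForm Unit (fun _ => n) Empty (fun e => e.elim),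
    ψ.free = ∅ ∧ ∀ (A : Type) (R : Set (Fin n → A)),
      D A R ↔ ∀ s : ℕ → A, ssat (fun _ => R) ψ s

section Semantics

variable {σ : Type} {ar : σ → ℕ} {δ : Type} {dar : δ → ℕ}

theorem TForm.free_finite (φ : TForm σ ar δ dar) : φ.free.Finite := by
  induction φ with
  | rel | nrel | dep => exact Set.finite_range _
  | eq | neq => exact (Set.finite_range _).union (Set.finite_range _)
  | and _ _ h₁ h₂ | or _ _ h₁ h₂ => exact h₁.union h₂
  | ex _ _ h | all _ _ h => exact h.subset Set.sdiff_subset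

/-- Tarski semantics depends only on the values of the free variables. -/
theorem ssat_congr {M : Type} (I : ∀ r : σ, Set (Fin (ar r) → M)) (φ : TForm σ ar δ dar)
    {s t : ℕ → M} (h : Set.EqOn s t φ.free) : ssat I φ s ↔ ssat I φ t := by
  induction φ generalizing s t with
  | rel r ts | nrel r ts =>
    have : (fun i => s (ts i)) = fun i => t (ts i) := funext fun i => h ⟨i, rfl⟩
    simp only [ssat, this]
  | eq k x y | neq k x y =>
    have hx : (fun i => s (x i)) = fun i => t (x i) := funext fun i => h (.inl ⟨i, rfl⟩)
    have hy : (fun i => s (y i)) = fun i => t (y i) := funext fun i => h (.inr ⟨i, rfl⟩)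
    simp only [ssat, hx, hy]
  | dep => rfl
  | and φ ψ h₁ h₂ | or φ ψ h₁ h₂ =>
    simp only [ssat, h₁ fun v hv => h (.inl hv), h₂ fun v hv => h (.inr hv)]
  | ex v φ ih | all v φ ih =>
    have key (m : M) : ssat I φ (Function.update s v m) ↔ ssat I φ (Function.update t v m) := by
      refine ih fun w hw => ?_
      by_cases hwv : w = v
      · simp [hwv]
      · simpa [hwv] using h ⟨hw, hwv⟩
    simp only [ssat, key]

theorem ssat_neg {dar : Empty → ℕ} {M : Type} (I : ∀ r : σ, Set (Fin (ar r) → M))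
    (φ : TForm σ ar Empty dar) (s : ℕ → M) : ssat I φ.neg s ↔ ¬ ssat I φ s := by
  induction φ generalizing s with
  | dep d => exact d.elim
  | _ => simp_all [ssat, TForm.neg, imp_iff_not_or]

variable {M : Type} {RI : ∀ r : σ, Set (Fin (ar r) → M)} {DI : DepFam δ dar}

/-- Every assignment of a team satisfying `φ` satisfies the flattening of `φ`. -/
theorem ssat_of_tsat {φ : TForm σ ar δ dar} {X : Team M} (h : tsat RI DI φ X) :
    ∀ s ∈ X, ssat RI φ s := by
  induction φ generalizing X with
  | rel | nrel | eq | neq => exact h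
  | dep => exact fun _ _ => trivial
  | and φ ψ h₁ h₂ => exact fun s hs => ⟨h₁ h.1 s hs, h₂ h.2 s hs⟩
  | or φ ψ h₁ h₂ =>
    obtain ⟨Y, Z, rfl, hY, hZ⟩ := h
    exact fun s hs => hs.imp (h₁ hY s) (h₂ hZ s)
  | ex v φ ih =>
    obtain ⟨H, hH, h⟩ := h
    intro s hs
    obtain ⟨m, hm⟩ := hH s hs
    exact ⟨m, ih h _ ⟨s, hs, m, hm, rfl⟩⟩
  | all v φ ih => exact fun s hs m => ih h _ ⟨s, hs, m, rfl⟩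

/-- Over upwards closed dependencies, satisfaction is preserved by enlarging the team inside the
set of assignments satisfying the flattening. -/
theorem tsat_mono (hup : UpClosed DI) {φ : TForm σ ar δ dar} {X Y : Team M}
    (h : tsat RI DI φ X) (hXY : X ⊆ Y) (hY : ∀ s ∈ Y, ssat RI φ s) : tsat RI DI φ Y := by
  induction φ generalizing X Y with
  | rel | nrel | eq | neq => exact hY
  | dep d xs =>
    refine hup d M (X.rel xs) (Y.rel xs) ?_ h
    rintro t ⟨s, hs, ht⟩
    exact ⟨s, hXY hs, ht⟩
  | and φ ψ h₁ h₂ =>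
    exact ⟨h₁ h.1 hXY fun s hs => (hY s hs).1, h₂ h.2 hXY fun s hs => (hY s hs).2⟩
  | or φ ψ h₁ h₂ =>
    obtain ⟨Z, W, rfl, hZ, hW⟩ := h
    refine ⟨{s ∈ Y | ssat RI φ s}, {s ∈ Y | ssat RI ψ s}, ?_, ?_, ?_⟩
    · ext s
      exact ⟨fun hs => (hY s hs).imp (⟨hs, ·⟩) (⟨hs, ·⟩), fun hs => hs.elim And.left And.left⟩
    · exact h₁ hZ (fun s hs => ⟨hXY (.inl hs), ssat_of_tsat hZ s hs⟩) fun s hs => hs.2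
    · exact h₂ hW (fun s hs => ⟨hXY (.inr hs), ssat_of_tsat hW s hs⟩) fun s hs => hs.2
  | ex v φ ih =>
    obtain ⟨H, hH, h⟩ := h
    refine ⟨fun s => {m | ssat RI φ (Function.update s v m)}, hY, ih h ?_ ?_⟩
    · rintro _ ⟨s, hs, m, hm, rfl⟩
      exact ⟨s, hXY hs, m, ssat_of_tsat h _ ⟨s, hs, m, hm, rfl⟩, rfl⟩
    · rintro _ ⟨s, hs, m, hm, rfl⟩
      exact hm
  | all v φ ih =>
    refine ih h (fun _ ⟨s, hs, m, e⟩ => ⟨s, hXY hs, m, e⟩) ?_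
    rintro _ ⟨s, hs, m, rfl⟩
    exact hY s hs m

/-- A disjunction is witnessed by the largest possible splitting of the team. -/
theorem tsat_or_iff (hup : UpClosed DI) {φ ψ : TForm σ ar δ dar} {X : Team M} :
    tsat RI DI (.or φ ψ) X ↔ (∀ s ∈ X, ssat RI (.or φ ψ) s) ∧
      tsat RI DI φ {s ∈ X | ssat RI φ s} ∧ tsat RI DI ψ {s ∈ X | ssat RI ψ s} := by
  constructor
  · intro h
    refine ⟨ssat_of_tsat h, ?_⟩
    obtain ⟨Y, Z, rfl, hY, hZ⟩ := h
    exact ⟨tsat_mono hup hY (fun s hs => ⟨.inl hs, ssat_of_tsat hY s hs⟩) fun s hs => hs.2,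
      tsat_mono hup hZ (fun s hs => ⟨.inr hs, ssat_of_tsat hZ s hs⟩) fun s hs => hs.2⟩
  · rintro ⟨h, h₁, h₂⟩
    refine ⟨_, _, ?_, h₁, h₂⟩
    ext s
    exact ⟨fun hs => (h s hs).imp (⟨hs, ·⟩) (⟨hs, ·⟩), fun hs => hs.elim And.left And.left⟩

/-- An existential quantifier is witnessed by the largest possible choice function. -/
theorem tsat_ex_iff (hup : UpClosed DI) {v : ℕ} {φ : TForm σ ar δ dar} {X : Team M} :
    tsat RI DI (.ex v φ) X ↔ (∀ s ∈ X, ssat RI (.ex v φ) s) ∧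
      tsat RI DI φ {s' | (∃ s ∈ X, ∃ m : M, s' = Function.update s v m) ∧ ssat RI φ s'} := by
  constructor
  · intro h
    refine ⟨ssat_of_tsat h, ?_⟩
    obtain ⟨H, hH, h⟩ := h
    refine tsat_mono hup h ?_ fun s hs => hs.2
    intro s' hs'
    have := ssat_of_tsat h s' hs'
    obtain ⟨s, hs, m, -, e⟩ := hs'
    exact ⟨⟨s, hs, m, e⟩, this⟩
  · rintro ⟨h, h₁⟩
    refine ⟨fun s => {m | ssat RI φ (Function.update s v m)}, h, tsat_mono hup h₁ ?_ ?_⟩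
    · rintro _ ⟨⟨s, hs, m, rfl⟩, hm⟩
      exact ⟨s, hs, m, hm, rfl⟩
    · rintro _ ⟨s, hs, m, hm, rfl⟩
      exact hm

end Semantics

section Definability

variable {τ : Type} {art : τ → ℕ}

/-- A property of assignments, uniform in the structure, is defined by a first-order formula. -/
def FODef (P : ∀ M : Type, (∀ r : τ, Set (Fin (art r) → M)) → (ℕ → M) → Prop) : Prop :=
  ∃ ψ : TForm τ art Empty (fun e => e.elim), ∀ M I s, ssat I ψ s ↔ P M I s

namespace FODef

variable {P Q : ∀ M : Type, (∀ r : τ, Set (Fin (art r) → M)) → (ℕ → M) → Prop}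

theorem and (hP : FODef P) (hQ : FODef Q) : FODef fun M I s => P M I s ∧ Q M I s := by
  obtain ⟨ψ, hψ⟩ := hP
  obtain ⟨χ, hχ⟩ := hQ
  exact ⟨.and ψ χ, fun M I s => and_congr (hψ M I s) (hχ M I s)⟩

theorem or (hP : FODef P) (hQ : FODef Q) : FODef fun M I s => P M I s ∨ Q M I s := by
  obtain ⟨ψ, hψ⟩ := hP
  obtain ⟨χ, hχ⟩ := hQ
  exact ⟨.or ψ χ, fun M I s => or_congr (hψ M I s) (hχ M I s)⟩

theorem not (hP : FODef P) : FODef fun M I s => ¬ P M I s := by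
  obtain ⟨ψ, hψ⟩ := hP
  exact ⟨ψ.neg, fun M I s => (ssat_neg I ψ s).trans (not_congr (hψ M I s))⟩

theorem imp (hP : FODef P) (hQ : FODef Q) : FODef fun M I s => P M I s → Q M I s := by
  simpa only [imp_iff_not_or] using hP.not.or hQ

theorem ex (hP : FODef P) (v : ℕ) : FODef fun M I s => ∃ m, P M I (Function.update s v m) := by
  obtain ⟨ψ, hψ⟩ := hP
  exact ⟨.ex v ψ, fun M I s => exists_congr fun m => hψ M I _⟩

theorem all (hP : FODef P) (v : ℕ) : FODef fun M I s => ∀ m, P M I (Function.update s v m) := by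
  obtain ⟨ψ, hψ⟩ := hP
  exact ⟨.all v ψ, fun M I s => forall_congr' fun m => hψ M I _⟩

theorem eq {n : ℕ} (x y : Fin n → ℕ) :
    FODef fun M (_ : ∀ r : τ, Set (Fin (art r) → M)) s =>
      (fun i => s (x i)) = fun i => s (y i) :=
  ⟨.eq n x y, fun _ _ _ => Iff.rfl⟩

theorem rel (r : τ) (ts : Fin (art r) → ℕ) :
    FODef fun M (I : ∀ r : τ, Set (Fin (art r) → M)) s => (fun i => s (ts i)) ∈ I r :=
  ⟨.rel r ts, fun _ _ _ => Iff.rfl⟩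

/-- Satisfaction in a structure that is first-order interpretable with the same carrier. -/
theorem ssat {τ' : Type} {art' : τ' → ℕ} {δ : Type} {dar : δ → ℕ} (χ : TForm τ' art' δ dar)
    {J : ∀ M : Type, (∀ r : τ, Set (Fin (art r) → M)) → ∀ r : τ', Set (Fin (art' r) → M)}
    (h : ∀ (r : τ') (ts : Fin (art' r) → ℕ), FODef fun M I s => (fun i => s (ts i)) ∈ J M I r) :
    FODef fun M I s => _root_.ssat (J M I) χ s := by
  induction χ with
  | rel r ts => exact h r ts
  | nrel r ts => exact (h r ts).not
  | eq k x y => exact eq x y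
  | neq k x y => exact (eq x y).not
  | dep => exact ⟨.eq 0 Fin.elim0 Fin.elim0, fun _ _ _ => ⟨fun _ => trivial, fun _ => rfl⟩⟩
  | and _ _ h₁ h₂ => exact h₁.and h₂
  | or _ _ h₁ h₂ => exact h₁.or h₂
  | ex v _ ih => exact ih.ex v
  | all v _ ih => exact ih.all v

/-- Renaming of variables. -/
theorem comp (hP : FODef P) (f : ℕ → ℕ) : FODef fun M I s => P M I (s ∘ f) := by
  obtain ⟨ψ, hψ⟩ := hP
  suffices FODef fun M (I : ∀ r : τ, Set (Fin (art r) → M)) s => _root_.ssat I ψ (s ∘ f) by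
    simpa only [hψ] using this
  clear hψ
  have fresh (f : ℕ → ℕ) (v : ℕ) (φ : TForm τ art Empty fun e => e.elim) :
      ∃ w, ∀ (M : Type) (I : ∀ r : τ, Set (Fin (art r) → M)) (s : ℕ → M) (m : M),
        _root_.ssat I φ (Function.update s w m ∘ Function.update f v w) ↔
          _root_.ssat I φ (Function.update (s ∘ f) v m) := by
    obtain ⟨w, hw⟩ := (φ.free_finite.image f).exists_notMem
    refine ⟨w, fun M I s m => ssat_congr I φ fun u hu => ?_⟩
    by_cases huv : u = v
    · simp [huv]
    · have : f u ≠ w := fun e => hw ⟨u, hu, e⟩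
      simp [huv, this]
  induction ψ generalizing f with
  | rel r ts => exact rel r (f ∘ ts)
  | nrel r ts => exact (rel r (f ∘ ts)).not
  | eq k x y => exact eq (f ∘ x) (f ∘ y)
  | neq k x y => exact (eq (f ∘ x) (f ∘ y)).not
  | dep d => exact d.elim
  | and _ _ h₁ h₂ => exact (h₁ f).and (h₂ f)
  | or _ _ h₁ h₂ => exact (h₁ f).or (h₂ f)
  | ex v φ ih =>
    obtain ⟨w, hw⟩ := fresh f v φ
    simpa only [hw, _root_.ssat] using (ih (Function.update f v w)).ex w
  | all v φ ih =>
    obtain ⟨w, hw⟩ := fresh f v φ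
    simpa only [hw, _root_.ssat] using (ih (Function.update f v w)).all w

/-- Existential quantification over a finite set of variables. -/
theorem exFinset (hP : FODef P) (L : Finset ℕ) :
    FODef fun M I s => ∃ s', (∀ v ∉ L, s' v = s v) ∧ P M I s' := by
  induction L using Finset.induction_on with
  | empty =>
    obtain ⟨ψ, hψ⟩ := hP
    refine ⟨ψ, fun M I s => (hψ M I s).trans ⟨fun h => ⟨s, fun _ _ => rfl, h⟩, ?_⟩⟩
    rintro ⟨s', hs', h⟩
    rwa [← funext fun v => hs' v (Finset.notMem_empty v)]
  | insert v L hv ih =>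
    obtain ⟨ψ, hψ⟩ := ih.ex v
    refine ⟨ψ, fun M I s => (hψ M I s).trans ⟨?_, ?_⟩⟩
    · rintro ⟨m, s', hs', h⟩
      refine ⟨s', fun w hw => ?_, h⟩
      rw [Finset.mem_insert, not_or] at hw
      rw [hs' w hw.2, Function.update_of_ne hw.1]
    · rintro ⟨s', hs', h⟩
      refine ⟨s' v, s', fun w hw => ?_, h⟩
      by_cases hwv : w = v
      · simp [hwv]
      · rw [Function.update_of_ne hwv]
        exact hs' w (by simp [hwv, hw])

/-- The relation of values of a tuple of variables over a definable team is definable. -/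
theorem image (hP : FODef P) {n : ℕ} (z ts : Fin n → ℕ) :
    FODef fun M I s => ∃ s', P M I s' ∧ (fun i => s (ts i)) = fun i => s' (z i) := by
  obtain ⟨N, hN⟩ : ∃ N, ∀ i, ts i < N := by
    obtain ⟨N, hN⟩ := (Set.finite_range ts).bddAbove
    exact ⟨N + 1, fun i => Nat.lt_succ_of_le (hN ⟨i, rfl⟩)⟩
  have hP' := hP
  obtain ⟨ψ, hψ⟩ := hP'
  let V := ψ.free_finite.toFinset ∪ (Set.finite_range z).toFinset
  obtain ⟨χ, hχ⟩ := ((hP.comp (· + N)).and (eq ts fun i => z i + N)).exFinset (V.image (· + N))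
  refine ⟨χ, fun M I s => (hχ M I s).trans ⟨?_, ?_⟩⟩
  · rintro ⟨s', hs', h, e⟩
    refine ⟨_, h, Eq.trans (funext fun i => (hs' _ ?_).symm) e⟩
    have := hN i
    simp only [Finset.mem_image, not_exists, not_and]
    omega
  · rintro ⟨s', h, e⟩
    have hs₁ : ∀ u ∈ V, (if u + N ∈ V.image (· + N) then s' (u + N - N) else s (u + N)) = s' u :=
      fun u hu => by rw [if_pos (Finset.mem_image_of_mem _ hu), Nat.add_sub_cancel]
    refine ⟨fun u => if u ∈ V.image (· + N) then s' (u - N) else s u,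
      fun u hu => if_neg hu, ?_, funext fun i => ?_⟩
    · rw [← hψ] at h ⊢
      refine (ssat_congr I ψ fun u hu => ?_).2 h
      exact hs₁ u (by simp [V, hu])
    · have hi : ts i ∉ V.image (· + N) := by
        have := hN i
        simp only [Finset.mem_image, not_exists, not_and]
        omega
      exact (if_neg hi).trans ((congrFun e i).trans (hs₁ (z i) (by simp [V])).symm)

end FODef

/-- Universal closure. -/
theorem TForm.exists_closed {dar : Empty → ℕ} (ψ : TForm τ art Empty dar) :
    ∃ χ : TForm τ art Empty dar, χ.free = ∅ ∧
      ∀ (M : Type) (I : ∀ r : τ, Set (Fin (art r) → M)),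
        (∀ s, ssat I χ s) ↔ ∀ s, ssat I ψ s := by
  suffices ∀ (L : Finset ℕ) (ψ : TForm τ art Empty dar), ψ.free ⊆ L →
      ∃ χ : TForm τ art Empty dar, χ.free = ∅ ∧
        ∀ (M : Type) (I : ∀ r : τ, Set (Fin (art r) → M)),
          (∀ s, ssat I χ s) ↔ ∀ s, ssat I ψ s from
    this ψ.free_finite.toFinset ψ (by simp)
  intro L
  induction L using Finset.induction_on with
  | empty => exact fun ψ h => ⟨ψ, by simpa using h, fun _ _ => Iff.rfl⟩
  | insert v L hv ih =>
    intro ψ h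
    obtain ⟨χ, hχ, e⟩ := ih (.all v ψ) (by simpa [TForm.free, Set.sdiff_singleton_subset_iff] using h)
    refine ⟨χ, hχ, fun M I => (e M I).trans ⟨fun H s => ?_, fun H s m => H _⟩⟩
    simpa using H s (s v)

end Definability

section Translation

variable {σ : Type} {ar : σ → ℕ} {δ : Type} {dar : δ → ℕ}

/-- The expansion of a structure by one more relation. -/
def expand {k : ℕ} {M : Type} (RI : ∀ r : σ, Set (Fin (ar r) → M)) (R : Set (Fin k → M)) :
    ∀ r : σ ⊕ Unit, Set (Fin (Sum.elim ar (fun _ => k) r) → M) :=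
  fun r => Sum.rec RI (fun _ => R) r

/-- A team property is expressed by a first-order formula about the relation of values of `x̄`. -/
def Translatable {k : ℕ} (xb : Fin k → ℕ)
    (T : ∀ M : Type, (∀ r : σ, Set (Fin (ar r) → M)) → Team M → Prop) : Prop :=
  ∃ ψ : TForm (σ ⊕ Unit) (Sum.elim ar fun _ => k) Empty (fun e => e.elim),
    ∀ (M : Type) (RI : ∀ r : σ, Set (Fin (ar r) → M)) (X : Team M),
      T M RI X ↔ ∀ s : ℕ → M, ssat (expand RI (X.rel xb)) ψ s

/-- Membership in `X` up to the values of `x̄`. -/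
theorem FODef.mem_rel {k : ℕ} (xb : Fin k → ℕ) :
    FODef fun M (I : ∀ r : σ ⊕ Unit, Set (Fin (Sum.elim ar (fun _ => k) r) → M)) s =>
      (fun i => s (xb i)) ∈ I (.inr ()) :=
  FODef.rel (art := Sum.elim ar fun _ => k) (.inr ()) xb

/-- Satisfaction of (the flattening of) a formula in the reduct to the original signature. -/
theorem FODef.ssat_inl (k : ℕ) (φ : TForm σ ar δ dar) :
    FODef fun M (I : ∀ r : σ ⊕ Unit, Set (Fin (Sum.elim ar (fun _ => k) r) → M)) s =>
      _root_.ssat (fun r => I (.inl r)) φ s :=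
  FODef.ssat φ fun r ts => FODef.rel (art := Sum.elim ar fun _ => k) (.inl r) ts

namespace Translatable

variable {k : ℕ} {xb : Fin k → ℕ}
  {T T' : ∀ M : Type, (∀ r : σ, Set (Fin (ar r) → M)) → Team M → Prop}

theorem and (h : Translatable xb T) (h' : Translatable xb T') :
    Translatable xb fun M RI X => T M RI X ∧ T' M RI X := by
  obtain ⟨ψ, hψ⟩ := h
  obtain ⟨χ, hχ⟩ := h'
  exact ⟨.and ψ χ, fun M RI X => by simp only [hψ, hχ, ssat, forall_and]⟩

/-- Flat properties. -/
theorem forall_mem_ssat {φ : TForm σ ar δ dar} (hφ : φ.free ⊆ Set.range xb) :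
    Translatable (σ := σ) (ar := ar) xb fun _ RI X => ∀ s ∈ X, ssat RI φ s := by
  obtain ⟨ψ, hψ⟩ := (FODef.mem_rel (ar := ar) xb).imp (FODef.ssat_inl k φ)
  refine ⟨ψ, fun M RI X => ?_⟩
  simp only [hψ]
  constructor
  · rintro h s ⟨s₀, hs₀, e⟩
    refine (ssat_congr RI φ fun v hv => ?_).2 (h s₀ hs₀)
    obtain ⟨i, rfl⟩ := hφ hv
    exact congrFun e i
  · exact fun h s hs => h s ⟨s, hs, rfl⟩

/-- Properties of a team whose relation of values is definable from `X(x̄)`. -/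
theorem preimage {n : ℕ} {z : Fin n → ℕ} (h : Translatable z T)
    {P : ∀ M : Type, (∀ r : σ ⊕ Unit, Set (Fin (Sum.elim ar (fun _ => k) r) → M)) →
      (ℕ → M) → Prop} (hP : FODef P)
    {G : ∀ M : Type, (∀ r : σ, Set (Fin (ar r) → M)) → Team M → Team M}
    (hG : ∀ M RI X, (G M RI X).rel z = Team.rel {s | P M (expand RI (X.rel xb)) s} z) :
    Translatable xb fun M RI X => T M RI (G M RI X) := by
  obtain ⟨χ, hχ⟩ := h
  have hJ : ∀ (r : σ ⊕ Unit) (ts : Fin (Sum.elim ar (fun _ => n) r) → ℕ), FODef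
      fun M (I : ∀ r : σ ⊕ Unit, Set (Fin (Sum.elim ar (fun _ => k) r) → M)) s =>
        (fun i => s (ts i)) ∈ expand (fun r => I (.inl r)) (Team.rel {s | P M I s} z) r := by
    rintro (r | u) ts
    · exact FODef.rel (art := Sum.elim ar fun _ => k) (.inl r) ts
    · exact hP.image z ts
  obtain ⟨ψ, hψ⟩ := FODef.ssat χ hJ
  refine ⟨ψ, fun M RI X => ?_⟩
  simp only [hψ, hχ, hG]
  rfl

/-- First-order definable properties of the values of a tuple of variables. -/
theorem dep {n : ℕ} {D : ∀ M : Type, Set (Fin n → M) → Prop} (hD : FODefinable n D)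
    {ys : Fin n → ℕ} (hys : Set.range ys ⊆ Set.range xb) :
    Translatable (σ := σ) (ar := ar) xb fun M _ X => D M (X.rel ys) := by
  obtain ⟨χ, -, hχ⟩ := hD
  obtain ⟨ψ, hψ⟩ := FODef.ssat χ
    (J := fun M (I : ∀ r : σ ⊕ Unit, Set (Fin (Sum.elim ar (fun _ => k) r) → M)) _ =>
      Team.rel {s : ℕ → M | (fun i => s (xb i)) ∈ I (.inr ())} ys)
    fun _ ts => (FODef.mem_rel (ar := ar) xb).image ys ts
  refine ⟨ψ, fun M RI X => ?_⟩
  simp only [hψ, hχ]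
  have : X.rel ys = Team.rel {s | (fun i => s (xb i)) ∈ X.rel xb} ys := by
    ext t
    constructor
    · rintro ⟨s, hs, rfl⟩
      exact ⟨s, ⟨s, hs, rfl⟩, rfl⟩
    · rintro ⟨s, ⟨s₀, hs₀, e⟩, rfl⟩
      refine ⟨s₀, hs₀, funext fun i => ?_⟩
      obtain ⟨j, hj⟩ := hys ⟨i, rfl⟩
      rw [← hj]
      exact congrFun e j
  rw [this]
  rfl

/-- Restriction of the team to the assignments satisfying a flattening. -/
theorem sep {φ : TForm σ ar δ dar} (hφ : φ.free ⊆ Set.range xb) (h : Translatable xb T) :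
    Translatable xb fun M RI X => T M RI {s ∈ X | ssat RI φ s} := by
  refine h.preimage ((FODef.mem_rel xb).and (FODef.ssat_inl k φ)) fun M RI X => ?_
  ext t
  constructor
  · rintro ⟨s, ⟨hs, hsφ⟩, rfl⟩
    exact ⟨s, ⟨⟨s, hs, rfl⟩, hsφ⟩, rfl⟩
  · rintro ⟨s, ⟨⟨s₀, hs₀, e⟩, hsφ⟩, rfl⟩
    refine ⟨s₀, ⟨hs₀, (ssat_congr RI φ fun v hv => ?_).1 hsφ⟩, e⟩
    obtain ⟨i, rfl⟩ := hφ hv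
    exact congrFun e i

/-- Duplication of the team along a variable. -/
theorem all {v : ℕ} (h : Translatable (Fin.cons v xb : Fin (k + 1) → ℕ) T) :
    Translatable xb fun M RI X => T M RI {s' | ∃ s ∈ X, ∃ m : M, s' = Function.update s v m} := by
  refine h.preimage ((FODef.mem_rel xb).ex v) fun M RI X => ?_
  ext t
  constructor
  · rintro ⟨_, ⟨s, hs, m, rfl⟩, rfl⟩
    exact ⟨_, ⟨s v, s, hs, by simp⟩, rfl⟩
  · rintro ⟨s, ⟨m, s₀, hs₀, e⟩, rfl⟩
    refine ⟨_, ⟨s₀, hs₀, s v, rfl⟩, funext fun i => ?_⟩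
    refine Fin.cases (by simp) (fun i => ?_) i
    have := congrFun e i
    by_cases hi : xb i = v
    · simp [hi]
    · simpa [hi] using this

end Translatable

theorem translatable_tsat {DI : DepFam δ dar} (hup : UpClosed DI)
    (hdef : ∀ d : δ, FODefinable (dar d) (DI d)) {k : ℕ} (xb : Fin k → ℕ)
    (φ : TForm σ ar δ dar) (hφ : φ.free ⊆ Set.range xb) :
    Translatable xb fun _ RI X => tsat RI DI φ X := by
  have cons_free {k : ℕ} {xb : Fin k → ℕ} {v : ℕ} {φ : TForm σ ar δ dar}
      (h : φ.free \ {v} ⊆ Set.range xb) :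
      φ.free ⊆ Set.range (Fin.cons v xb : Fin (k + 1) → ℕ) := by
    rwa [Fin.range_cons, ← Set.sdiff_singleton_subset_iff]
  induction φ generalizing k with
  | rel | nrel | eq | neq => exact Translatable.forall_mem_ssat hφ
  | dep d xs => exact Translatable.dep (hdef d) hφ
  | and φ ψ h₁ h₂ =>
    have hφ' := Set.union_subset_iff.1 hφ
    exact (h₁ xb hφ'.1).and (h₂ xb hφ'.2)
  | or φ ψ h₁ h₂ =>
    have hφ' := Set.union_subset_iff.1 hφ
    simp only [tsat_or_iff hup]
    exact (Translatable.forall_mem_ssat hφ).and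
      (((h₁ xb hφ'.1).sep hφ'.1).and ((h₂ xb hφ'.2).sep hφ'.2))
  | ex v φ ih =>
    simp only [tsat_ex_iff hup]
    exact (Translatable.forall_mem_ssat hφ).and
      ((ih (Fin.cons v xb) (cons_free hφ)).sep (cons_free hφ)).all
  | all v φ ih => exact (ih (Fin.cons v xb) (cons_free hφ)).all

end Translation

/-- **Main theorem on upwards closed dependencies.**  If every dependency in
`D` is upwards closed and first-order definable, then for every `FO(D)`-formula
`φ` with free variables among `x̄` there is a first-order sentence `φ*(R)` over
the signature extended by a new `|x̄|`-ary relation symbol `R` such that for all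
models `M` and teams `X`: `M ⊨_X φ(x̄)` iff `(M, X(x̄)) ⊨ φ*(R)`.
(In particular every sentence of `FO(D)` is equivalent to a first-order one.) -/
theorem upwards_closed_fo {σ : Type} {ar : σ → ℕ} {δ : Type} {dar : δ → ℕ}
    (DI : DepFam δ dar) (hup : UpClosed DI)
    (hdef : ∀ d : δ, FODefinable (dar d) (DI d))
    {k : ℕ} (xb : Fin k → ℕ) (φ : TForm σ ar δ dar) (hfree : φ.free ⊆ Set.range xb) :
    ∃ ψ : TForm (σ ⊕ Unit) (Sum.elim ar fun _ => k) Empty (fun e => e.elim),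
      ψ.free = ∅ ∧
      ∀ (M : Type) [Nontrivial M] (RI : ∀ r : σ, Set (Fin (ar r) → M)) (X : Team M),
        tsat RI DI φ X ↔
          ∀ s : ℕ → M,
            ssat (fun r : σ ⊕ Unit =>
              match r with
              | .inl r => RI r
              | .inr _ => X.rel xb) ψ s := by
  obtain ⟨ψ, hψ⟩ := translatable_tsat hup hdef xb φ hfree
  obtain ⟨χ, hχ, e⟩ := ψ.exists_closed
  refine ⟨χ, hχ, fun M _ RI X => (hψ M RI X).trans ((e M _).symm.trans ?_)⟩
  have : expand RI (X.rel xb) = fun r : σ ⊕ Unit =>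
      match r with
      | .inl r => RI r
      | .inr _ => X.rel xb := by
    funext r
    cases r <;> rfl
  rw [this]
end

section
/- Let D be any family of dependencies and φ(x̄) an FO(=(·), D)-formula (first-order logic with constancy atoms and D-atoms). Then φ(x̄) is logically equivalent to a formula of the form ∃v̄ (=(v̄) ∧ ψ(x̄, v̄)), where ψ ∈ FO(D) contains no constancy atoms and contains exactly the same instances of D-atoms as φ. -/
/-- Iterated existential quantification (outermost quantifier is `v 0`). -/
def TForm.exs {σ : Type} {ar : σ → ℕ} {δ : Type} {dar : δ → ℕ} :
    {n : ℕ} → (Fin n → ℕ) → TForm σ ar δ dar → TForm σ ar δ dar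
  | 0, _, φ => φ
  | _ + 1, v, φ => .ex (v 0) (TForm.exs (fun i => v i.succ) φ)

/-- The multiset of instances of dependency atoms occurring in a formula. -/
def TForm.depAtoms {σ : Type} {ar : σ → ℕ} {δ : Type} {dar : δ → ℕ} :
    TForm σ ar δ dar → Multiset ((d : δ) × (Fin (dar d) → ℕ))
  | .dep d xs => {⟨d, xs⟩}
  | .and φ ψ => φ.depAtoms + ψ.depAtoms
  | .or φ ψ => φ.depAtoms + ψ.depAtoms
  | .ex _ φ => φ.depAtoms
  | .all _ φ => φ.depAtoms
  | _ => 0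

section ConstancyExtraction

variable {σ : Type} {ar : σ → ℕ} {δ : Type} {dar : δ → ℕ} {M : Type}

/-- All variables, free or bound, occurring in a formula. -/
def TForm.vars : TForm σ ar δ dar → Finset ℕ
  | .rel _ ts => Finset.univ.image ts
  | .nrel _ ts => Finset.univ.image ts
  | .eq _ x y => Finset.univ.image x ∪ Finset.univ.image y
  | .neq _ x y => Finset.univ.image x ∪ Finset.univ.image y
  | .dep _ xs => Finset.univ.image xs
  | .and φ ψ => φ.vars ∪ ψ.vars
  | .or φ ψ => φ.vars ∪ ψ.vars
  | .ex v φ => insert v φ.vars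
  | .all v φ => insert v φ.vars

/-- The sum of the arities of the constancy atoms occurring in a formula. -/
def TForm.constWidth : TForm σ ar (δ ⊕ ℕ) (Sum.elim dar id) → ℕ
  | .dep (.inr k) _ => k
  | .and φ ψ => φ.constWidth + ψ.constWidth
  | .or φ ψ => φ.constWidth + ψ.constWidth
  | .ex _ φ => φ.constWidth
  | .all _ φ => φ.constWidth
  | _ => 0

/-- Replace the constancy atoms of a formula, from left to right, by equalities with consecutive
variables starting at `n`. -/
def TForm.constToEq :
    TForm σ ar (δ ⊕ ℕ) (Sum.elim dar id) → ℕ → TForm σ ar (δ ⊕ ℕ) (Sum.elim dar id)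
  | .rel r ts, _ => .rel r ts
  | .nrel r ts, _ => .nrel r ts
  | .eq k x y, _ => .eq k x y
  | .neq k x y, _ => .neq k x y
  | .dep (.inl d) xs, _ => .dep (.inl d) xs
  | .dep (.inr k) xs, n => .eq k xs (fun i => n + i)
  | .and φ ψ, n => .and (φ.constToEq n) (ψ.constToEq (n + φ.constWidth))
  | .or φ ψ, n => .or (φ.constToEq n) (ψ.constToEq (n + φ.constWidth))
  | .ex v φ, n => .ex v (φ.constToEq n)
  | .all v φ, n => .all v (φ.constToEq n)

/-- Team semantics in which the constancy atoms, from left to right, assert that their tuple takes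
the value prescribed by the consecutive entries of `c` starting at `n`. -/
def tsatAt (RI : ∀ r : σ, Set (Fin (ar r) → M)) (E : DepFam (δ ⊕ ℕ) (Sum.elim dar id))
    (c : ℕ → M) : TForm σ ar (δ ⊕ ℕ) (Sum.elim dar id) → ℕ → Team M → Prop
  | .rel r ts, _, X => tsat RI E (.rel r ts) X
  | .nrel r ts, _, X => tsat RI E (.nrel r ts) X
  | .eq k x y, _, X => tsat RI E (.eq k x y) X
  | .neq k x y, _, X => tsat RI E (.neq k x y) X
  | .dep (.inl d) xs, _, X => tsat RI E (.dep (.inl d) xs) X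
  | .dep (.inr k) xs, n, X => ∀ s ∈ X, ∀ i : Fin k, s (xs i) = c (n + i)
  | .and φ ψ, n, X => tsatAt RI E c φ n X ∧ tsatAt RI E c ψ (n + φ.constWidth) X
  | .or φ ψ, n, X => ∃ Y Z, X = Y ∪ Z ∧ tsatAt RI E c φ n Y ∧
      tsatAt RI E c ψ (n + φ.constWidth) Z
  | .ex v φ, n, X => ∃ H : (ℕ → M) → Set M, (∀ s ∈ X, (H s).Nonempty) ∧
      tsatAt RI E c φ n {s' | ∃ s ∈ X, ∃ m ∈ H s, s' = Function.update s v m}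
  | .all v φ, n, X => tsatAt RI E c φ n {s' | ∃ s ∈ X, ∃ m : M, s' = Function.update s v m}

theorem TForm.depAtoms_constToEq (φ : TForm σ ar (δ ⊕ ℕ) (Sum.elim dar id)) (n : ℕ) :
    (φ.constToEq n).depAtoms = φ.depAtoms.filter (fun a => a.fst.isLeft = true) := by
  induction φ generalizing n with
  | dep d xs => cases d <;> simp [constToEq, depAtoms, Multiset.filter_singleton]
  | _ => simp_all [constToEq, depAtoms]

theorem tsatAt_congr {RI : ∀ r : σ, Set (Fin (ar r) → M)}
    {E : DepFam (δ ⊕ ℕ) (Sum.elim dar id)} {c c' : ℕ → M}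
    (φ : TForm σ ar (δ ⊕ ℕ) (Sum.elim dar id)) {n : ℕ} {X : Team M}
    (h : ∀ i, n ≤ i → i < n + φ.constWidth → c i = c' i) (hφ : tsatAt RI E c φ n X) :
    tsatAt RI E c' φ n X := by
  induction φ generalizing n X with
  | dep d xs =>
    cases d with
    | inl d => exact hφ
    | inr k =>
      intro s hs i
      rw [← h _ (by lia) (by simp [TForm.constWidth])]
      exact hφ s hs i
  | and φ ψ ih₁ ih₂ =>
    simp only [TForm.constWidth] at h
    exact ⟨ih₁ (fun i _ _ => h i (by lia) (by lia)) hφ.1,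
      ih₂ (fun i _ _ => h i (by lia) (by lia)) hφ.2⟩
  | or φ ψ ih₁ ih₂ =>
    simp only [TForm.constWidth] at h
    obtain ⟨Y, Z, hX, hY, hZ⟩ := hφ
    exact ⟨Y, Z, hX, ih₁ (fun i _ _ => h i (by lia) (by lia)) hY,
      ih₂ (fun i _ _ => h i (by lia) (by lia)) hZ⟩
  | ex v φ ih =>
    obtain ⟨H, hH, hφ⟩ := hφ
    exact ⟨H, hH, ih h hφ⟩
  | all v φ ih => exact ih h hφ
  | _ => exact hφ

theorem tsatAt_glue {RI : ∀ r : σ, Set (Fin (ar r) → M)}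
    {E : DepFam (δ ⊕ ℕ) (Sum.elim dar id)} {c₁ c₂ : ℕ → M}
    {φ ψ : TForm σ ar (δ ⊕ ℕ) (Sum.elim dar id)} {n : ℕ} {Y Z : Team M}
    (hφ : tsatAt RI E c₁ φ n Y) (hψ : tsatAt RI E c₂ ψ (n + φ.constWidth) Z) :
    ∃ c, tsatAt RI E c φ n Y ∧ tsatAt RI E c ψ (n + φ.constWidth) Z := by
  refine ⟨fun i => if i < n + φ.constWidth then c₁ i else c₂ i,
    tsatAt_congr φ (fun i _ hi => ?_) hφ, tsatAt_congr ψ (fun i hi _ => ?_) hψ⟩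
  · simp [hi]
  · simp [hi]

theorem tsat_iff_exists_tsatAt [Nonempty M] {RI : ∀ r : σ, Set (Fin (ar r) → M)}
    {E : DepFam (δ ⊕ ℕ) (Sum.elim dar id)} (hE : ∀ k R, E (.inr k) M R ↔ ConstD k M R)
    (φ : TForm σ ar (δ ⊕ ℕ) (Sum.elim dar id)) (n : ℕ) (X : Team M) :
    tsat RI E φ X ↔ ∃ c, tsatAt RI E c φ n X := by
  induction φ generalizing n X with
  | dep d xs =>
    cases d with
    | inl d => simp [tsatAt]
    | inr k =>
      simp only [tsat, tsatAt, hE]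
      constructor
      · intro h
        rcases X.eq_empty_or_nonempty with rfl | ⟨s₀, hs₀⟩
        · exact ⟨fun _ => Classical.arbitrary M, by simp⟩
        · refine ⟨fun j => if hj : j - n < k then s₀ (xs ⟨j - n, hj⟩) else s₀ 0,
            fun s hs i => ?_⟩
          have := congrFun (h _ ⟨s, hs, rfl⟩ _ ⟨s₀, hs₀, rfl⟩) i
          simpa using this
      · rintro ⟨c, hc⟩ _ ⟨s, hs, rfl⟩ _ ⟨s', hs', rfl⟩
        funext i
        exact (hc s hs i).trans (hc s' hs' i).symm
  | and φ ψ ih₁ ih₂ =>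
    simp only [tsat, tsatAt, ih₁ n, ih₂ (n + φ.constWidth)]
    exact ⟨fun ⟨⟨_, h₁⟩, ⟨_, h₂⟩⟩ => tsatAt_glue h₁ h₂, fun ⟨c, h₁, h₂⟩ => ⟨⟨c, h₁⟩, ⟨c, h₂⟩⟩⟩
  | or φ ψ ih₁ ih₂ =>
    simp only [tsat, tsatAt, ih₁ n, ih₂ (n + φ.constWidth)]
    constructor
    · rintro ⟨Y, Z, hX, ⟨_, h₁⟩, ⟨_, h₂⟩⟩
      obtain ⟨c, h₁, h₂⟩ := tsatAt_glue h₁ h₂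
      exact ⟨c, Y, Z, hX, h₁, h₂⟩
    · rintro ⟨c, Y, Z, hX, h₁, h₂⟩
      exact ⟨Y, Z, hX, ⟨c, h₁⟩, ⟨c, h₂⟩⟩
  | ex v φ ih =>
    simp only [tsat, tsatAt, ih n]
    exact ⟨fun ⟨H, hH, c, h⟩ => ⟨c, H, hH, h⟩, fun ⟨c, H, hH, h⟩ => ⟨H, hH, c, h⟩⟩
  | all v φ ih => simp only [tsat, tsatAt, ih n]
  | _ => simp [tsatAt]

theorem tsat_constToEq_empty {RI : ∀ r : σ, Set (Fin (ar r) → M)}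
    {E : DepFam (δ ⊕ ℕ) (Sum.elim dar id)} (hE : ∀ k R, E (.inr k) M R ↔ ConstD k M R)
    (φ : TForm σ ar (δ ⊕ ℕ) (Sum.elim dar id)) (n : ℕ) :
    tsat RI E (φ.constToEq n) ∅ ↔ tsat RI E φ ∅ := by
  induction φ generalizing n with
  | dep d xs =>
    cases d with
    | inl d => rfl
    | inr k =>
      refine iff_of_true (fun s hs => hs.elim) ((hE k _).2 ?_)
      rintro _ ⟨_, ⟨⟩, _⟩
  | or φ ψ ih₁ ih₂ =>
    have key : ∀ A B : Team M → Prop,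
        (∃ Y Z, (∅ : Team M) = Y ∪ Z ∧ A Y ∧ B Z) ↔ A ∅ ∧ B ∅ := by
      intro A B
      constructor
      · rintro ⟨Y, Z, h, hY, hZ⟩
        obtain ⟨rfl, rfl⟩ := Set.union_empty_iff.1 h.symm
        exact ⟨hY, hZ⟩
      · exact fun h => ⟨∅, ∅, by simp, h⟩
    simp only [TForm.constToEq, tsat, key, ih₁, ih₂]
  | _ => simp_all [TForm.constToEq, tsat]

theorem tsat_exs_empty {RI : ∀ r : σ, Set (Fin (ar r) → M)} {E : DepFam δ dar}
    (φ : TForm σ ar δ dar) {m : ℕ} (v : Fin m → ℕ) :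
    tsat RI E (.exs v φ) ∅ ↔ tsat RI E φ ∅ := by
  induction m with
  | zero => rfl
  | succ m ih => simp [TForm.exs, tsat, ih]

open scoped Classical in
/-- The assignment that takes the values of `c` on `S` and those of `s` elsewhere. -/
noncomputable def overwrite (S : Set ℕ) (c s : ℕ → M) : ℕ → M :=
  fun j => if j ∈ S then c j else s j

theorem overwrite_of_mem {S : Set ℕ} {c s : ℕ → M} {j : ℕ} (hj : j ∈ S) :
    overwrite S c s j = c j :=
  if_pos hj

theorem overwrite_of_notMem {S : Set ℕ} {c s : ℕ → M} {j : ℕ} (hj : j ∉ S) :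
    overwrite S c s j = s j :=
  if_neg hj

theorem overwrite_update {S : Set ℕ} {v : ℕ} (hv : v ∉ S) (c s : ℕ → M) (m : M) :
    overwrite S c (Function.update s v m) = Function.update (overwrite S c s) v m := by
  funext j
  simp only [overwrite, Function.update_apply]
  grind

/-- Overwriting every assignment on a set `S` of variables not occurring in `φ`, with the values
given by `c`, turns `φ.constToEq n` into the semantics of `φ` at the values `c`. -/
theorem tsat_constToEq_image {RI : ∀ r : σ, Set (Fin (ar r) → M)}
    {E : DepFam (δ ⊕ ℕ) (Sum.elim dar id)} {c : ℕ → M} {S : Set ℕ}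
    (φ : TForm σ ar (δ ⊕ ℕ) (Sum.elim dar id)) {n : ℕ} (X : Team M)
    (hvars : ∀ v ∈ φ.vars, v ∉ S) (hS : ∀ i, n ≤ i → i < n + φ.constWidth → i ∈ S) :
    tsat RI E (φ.constToEq n) (overwrite S c '' X) ↔ tsatAt RI E c φ n X := by
  induction φ generalizing n X with
  | rel r ts | nrel r ts =>
    have h : ∀ i, ts i ∉ S := fun i => hvars _ (by simp [TForm.vars])
    simp [TForm.constToEq, tsatAt, tsat, overwrite_of_notMem, h]
  | eq k x y | neq k x y =>
    have hx : ∀ i, x i ∉ S := fun i => hvars _ (by simp [TForm.vars])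
    have hy : ∀ i, y i ∉ S := fun i => hvars _ (by simp [TForm.vars])
    simp [TForm.constToEq, tsatAt, tsat, overwrite_of_notMem, hx, hy]
  | dep d xs =>
    have h : ∀ i, xs i ∉ S := fun i => hvars _ (by simp [TForm.vars])
    cases d with
    | inl d =>
      have hrel : Team.rel (overwrite S c '' X) xs = X.rel xs := by
        ext t
        simp only [Team.rel, Set.exists_mem_image, Set.mem_ofPred_eq, overwrite_of_notMem (h _)]
      simp only [TForm.constToEq, tsatAt, tsat, hrel]
    | inr k =>
      have hk : ∀ i : Fin k, n + (i : ℕ) ∈ S := fun i =>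
        hS _ (by lia) (by simp [TForm.constWidth])
      simp only [TForm.constToEq, tsatAt, tsat, Set.forall_mem_image, funext_iff]
      refine forall₂_congr fun s _ => forall_congr' fun i => ?_
      rw [overwrite_of_notMem (h i), overwrite_of_mem (hk i)]
  | and φ ψ ih₁ ih₂ =>
    simp only [TForm.vars, Finset.mem_union, TForm.constWidth] at hvars hS
    simp only [TForm.constToEq, tsatAt, tsat]
    rw [ih₁ X (fun v hv => hvars v (.inl hv)) fun i _ _ => hS i (by lia) (by lia),
      ih₂ X (fun v hv => hvars v (.inr hv)) fun i _ _ => hS i (by lia) (by lia)]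
  | or φ ψ ih₁ ih₂ =>
    simp only [TForm.vars, Finset.mem_union, TForm.constWidth] at hvars hS
    replace ih₁ := fun X => ih₁ (n := n) X (fun v hv => hvars v (.inl hv))
      fun i _ _ => hS i (by lia) (by lia)
    replace ih₂ := fun X => ih₂ (n := n + φ.constWidth) X (fun v hv => hvars v (.inr hv))
      fun i _ _ => hS i (by lia) (by lia)
    simp only [TForm.constToEq, tsatAt, tsat]
    constructor
    · rintro ⟨Y, Z, hX, hY, hZ⟩
      have hYX : overwrite S c '' (X ∩ overwrite S c ⁻¹' Y) = Y := by
        rw [Set.image_inter_preimage, hX, Set.union_inter_cancel_left]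
      have hZX : overwrite S c '' (X ∩ overwrite S c ⁻¹' Z) = Z := by
        rw [Set.image_inter_preimage, hX, Set.union_inter_cancel_right]
      refine ⟨X ∩ overwrite S c ⁻¹' Y, X ∩ overwrite S c ⁻¹' Z, ?_,
        (ih₁ _).1 (hYX.symm ▸ hY), (ih₂ _).1 (hZX.symm ▸ hZ)⟩
      rw [← Set.inter_union_distrib_left, ← Set.preimage_union, ← hX]
      exact (Set.inter_eq_left.2 (Set.subset_preimage_image _ _)).symm
    · rintro ⟨Y, Z, rfl, hY, hZ⟩
      exact ⟨_, _, Set.image_union .., (ih₁ Y).2 hY, (ih₂ Z).2 hZ⟩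
  | ex v φ ih =>
    simp only [TForm.vars, Finset.mem_insert, TForm.constWidth] at hvars hS
    have hv := hvars v (.inl rfl)
    replace ih := fun X => ih (n := n) X (fun v hv => hvars v (.inr hv)) hS
    simp only [TForm.constToEq, tsatAt, tsat]
    constructor
    · rintro ⟨H, hH, h⟩
      refine ⟨fun s => H (overwrite S c s), fun s hs => hH _ ⟨s, hs, rfl⟩, (ih _).1 ?_⟩
      convert h using 1
      ext t
      constructor
      · rintro ⟨_, ⟨s, hs, m, hm, rfl⟩, rfl⟩
        exact ⟨_, ⟨s, hs, rfl⟩, m, hm, overwrite_update hv c s m⟩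
      · rintro ⟨_, ⟨s, hs, rfl⟩, m, hm, rfl⟩
        exact ⟨_, ⟨s, hs, m, hm, rfl⟩, overwrite_update hv c s m⟩
    · rintro ⟨H, hH, h⟩
      refine ⟨fun t => {m | ∃ s ∈ X, overwrite S c s = t ∧ m ∈ H s}, ?_, ?_⟩
      · rintro _ ⟨s, hs, rfl⟩
        obtain ⟨m, hm⟩ := hH s hs
        exact ⟨m, s, hs, rfl, hm⟩
      · convert (ih _).2 h using 1
        ext t
        constructor
        · rintro ⟨_, -, m, ⟨s, hs, rfl, hm⟩, rfl⟩
          exact ⟨_, ⟨s, hs, m, hm, rfl⟩, overwrite_update hv c s m⟩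
        · rintro ⟨_, ⟨s, hs, m, hm, rfl⟩, rfl⟩
          exact ⟨_, ⟨s, hs, rfl⟩, m, ⟨s, hs, rfl, hm⟩, overwrite_update hv c s m⟩
  | all v φ ih =>
    simp only [TForm.vars, Finset.mem_insert, TForm.constWidth] at hvars hS
    have hv := hvars v (.inl rfl)
    simp only [TForm.constToEq, tsatAt, tsat]
    rw [← ih _ (fun v hv => hvars v (.inr hv)) hS]
    congr! 1
    ext t
    constructor
    · rintro ⟨_, ⟨s, hs, rfl⟩, m, rfl⟩
      exact ⟨_, ⟨s, hs, m, rfl⟩, overwrite_update hv c s m⟩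
    · rintro ⟨_, ⟨s, hs, m, rfl⟩, rfl⟩
      exact ⟨_, ⟨s, hs, rfl⟩, m, overwrite_update hv c s m⟩

/-- A witnessing team of `∃v̄ φ` agrees with the original team off the quantified variables. -/
theorem exists_team_of_tsat_exs {RI : ∀ r : σ, Set (Fin (ar r) → M)} {E : DepFam δ dar}
    {φ : TForm σ ar δ dar} {m : ℕ} {v : Fin m → ℕ} {X : Team M}
    (h : tsat RI E (.exs v φ) X) :
    ∃ Y, tsat RI E φ Y ∧ (∀ t ∈ Y, ∃ s ∈ X, ∀ j ∉ Set.range v, t j = s j) ∧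
      ∀ s ∈ X, ∃ t ∈ Y, ∀ j ∉ Set.range v, t j = s j := by
  induction m generalizing X with
  | zero => exact ⟨X, h, fun t ht => ⟨t, ht, fun _ _ => rfl⟩, fun t ht => ⟨t, ht, fun _ _ => rfl⟩⟩
  | succ m ih =>
    obtain ⟨H, hH, h⟩ := h
    obtain ⟨Y, hY, hYX, hXY⟩ := ih h
    have hoff : ∀ j ∉ Set.range v, j ≠ v 0 ∧ j ∉ Set.range fun i : Fin m => v i.succ := by
      refine fun j hj => ⟨fun h => hj ⟨0, h.symm⟩, ?_⟩
      rintro ⟨i, hi⟩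
      exact hj ⟨i.succ, hi⟩
    refine ⟨Y, hY, fun t ht => ?_, fun s hs => ?_⟩
    · obtain ⟨_, ⟨s, hs, a, -, rfl⟩, hts⟩ := hYX t ht
      refine ⟨s, hs, fun j hj => ?_⟩
      rw [hts j (hoff j hj).2, Function.update_of_ne (hoff j hj).1]
    · obtain ⟨a, ha⟩ := hH s hs
      obtain ⟨t, ht, hts⟩ := hXY _ ⟨s, hs, a, ha, rfl⟩
      refine ⟨t, ht, fun j hj => ?_⟩
      rw [hts j (hoff j hj).2, Function.update_of_ne (hoff j hj).1]

theorem tsat_exs_of_image {RI : ∀ r : σ, Set (Fin (ar r) → M)} {E : DepFam δ dar}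
    {φ : TForm σ ar δ dar} {m : ℕ} {v : Fin m → ℕ} {X : Team M} (c : ℕ → M)
    (h : tsat RI E φ (overwrite (Set.range v) c '' X)) : tsat RI E (.exs v φ) X := by
  induction m generalizing X with
  | zero =>
    have : overwrite (Set.range v) c '' X = X := by
      have hid : overwrite (Set.range v) c = id := by
        funext s j
        exact overwrite_of_notMem (by simp)
      rw [hid, Set.image_id]
    rwa [this] at h
  | succ m ih =>
    refine ⟨fun _ => {c (v 0)}, fun _ _ => Set.singleton_nonempty _, ih ?_⟩
    convert h using 1
    have key : ∀ s : ℕ → M, overwrite (Set.range fun i : Fin m => v i.succ) c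
        (Function.update s (v 0) (c (v 0))) = overwrite (Set.range v) c s := by
      intro s
      funext j
      simp only [overwrite, Set.mem_range, Fin.exists_fin_succ, Function.update_apply]
      by_cases h₀ : v 0 = j <;> by_cases h₁ : ∃ i : Fin m, v i.succ = j <;>
        simp [h₀, h₁, eq_comm (a := j)]
    ext t
    simp [key]

theorem tsat_exs_const_iff {RI : ∀ r : σ, Set (Fin (ar r) → M)}
    {E : DepFam (δ ⊕ ℕ) (Sum.elim dar id)} (hE : ∀ k R, E (.inr k) M R ↔ ConstD k M R)
    (ψ : TForm σ ar (δ ⊕ ℕ) (Sum.elim dar id)) {m : ℕ} (v : Fin m → ℕ) {X : Team M}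
    (hX : X.Nonempty) :
    tsat RI E (.exs v (.and (.dep (.inr m) v) ψ)) X ↔
      ∃ c, tsat RI E ψ (overwrite (Set.range v) c '' X) := by
  constructor
  · intro h
    obtain ⟨Y, ⟨hc, hψ⟩, hYX, hXY⟩ := exists_team_of_tsat_exs h
    obtain ⟨s₀, hs₀⟩ := hX
    obtain ⟨t₀, ht₀, -⟩ := hXY s₀ hs₀
    have hconst : ∀ t ∈ Y, ∀ i, t (v i) = t₀ (v i) := fun t ht i =>
      congrFun ((hE _ _).1 hc _ ⟨t, ht, rfl⟩ _ ⟨t₀, ht₀, rfl⟩) i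
    have hpw : ∀ t ∈ Y, ∀ s : ℕ → M, (∀ j ∉ Set.range v, t j = s j) →
        overwrite (Set.range v) t₀ s = t := by
      intro t ht s hts
      funext j
      by_cases hj : j ∈ Set.range v
      · obtain ⟨i, rfl⟩ := hj
        rw [overwrite_of_mem (Set.mem_range_self i), hconst t ht i]
      · rw [overwrite_of_notMem hj, hts j hj]
    refine ⟨t₀, ?_⟩
    convert hψ using 1
    ext t
    constructor
    · rintro ⟨s, hs, rfl⟩
      obtain ⟨t, ht, hts⟩ := hXY s hs
      exact (hpw t ht s hts).symm ▸ ht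
    · intro ht
      obtain ⟨s, hs, hts⟩ := hYX t ht
      exact ⟨s, hs, hpw t ht s hts⟩
  · rintro ⟨c, h⟩
    refine tsat_exs_of_image c ⟨(hE _ _).2 ?_, h⟩
    rintro _ ⟨_, ⟨s, -, rfl⟩, rfl⟩ _ ⟨_, ⟨s', -, rfl⟩, rfl⟩
    funext i
    have hi := Set.mem_range_self (f := v) i
    exact (overwrite_of_mem hi).trans (overwrite_of_mem hi).symm

end ConstancyExtraction

/-- **Extraction of constancy atoms.**  In `FO(=(·), D)` — dependency atoms are
indexed by `δ ⊕ ℕ`, where `.inr m` is the constancy atom of arity `m` — every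
formula `φ` is equivalent to one of the form `∃v̄ (=(v̄) ∧ ψ)` where `ψ`
contains no constancy atoms and exactly the same instances of `D`-atoms as `φ`,
in the same number. -/
theorem const_extraction {σ : Type} {ar : σ → ℕ} {δ : Type} {dar : δ → ℕ}
    (DI : DepFam δ dar)
    (φ : TForm σ ar (δ ⊕ ℕ) (Sum.elim dar id)) :
    ∃ (m : ℕ) (vb : Fin m → ℕ) (ψ : TForm σ ar (δ ⊕ ℕ) (Sum.elim dar id)),
      (∀ a ∈ ψ.depAtoms, a.fst.isLeft) ∧
      ψ.depAtoms = φ.depAtoms.filter (fun a => a.fst.isLeft = true) ∧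
      ∀ (M : Type) (RI : ∀ r : σ, Set (Fin (ar r) → M)) (X : Team M),
        tsat RI (fun d => match d with | .inl d => DI d | .inr n => ConstD n) φ X ↔
        tsat RI (fun d => match d with | .inl d => DI d | .inr n => ConstD n)
          (TForm.exs vb (.and (.dep (.inr m) vb) ψ)) X := by
  let N := φ.vars.sup id + 1
  refine ⟨φ.constWidth, fun i => N + i, φ.constToEq N, ?_, φ.depAtoms_constToEq N, ?_⟩
  · rw [φ.depAtoms_constToEq N]
    exact fun a ha => (Multiset.mem_filter.1 ha).2
  intro M RI X
  rcases X.eq_empty_or_nonempty with rfl | hX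
  · rw [tsat_exs_empty, tsat, tsat_constToEq_empty fun _ _ => Iff.rfl]
    exact (and_iff_right (by rintro _ ⟨_, ⟨⟩, _⟩)).symm
  · have : Nonempty M := ⟨hX.some 0⟩
    rw [tsat_exs_const_iff (fun _ _ => Iff.rfl) _ _ hX,
      tsat_iff_exists_tsatAt (fun _ _ => Iff.rfl) φ N X]
    refine exists_congr fun c => (tsat_constToEq_image φ X ?_ ?_).symm
    · rintro v hv ⟨i, rfl⟩
      have : N + (i : ℕ) ≤ φ.vars.sup id := Finset.le_sup (f := id) hv
      lia
    · exact fun i h₁ h₂ => ⟨⟨i - N, by lia⟩, Nat.add_sub_cancel' h₁⟩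
end

section
/- Let D be a family of bounded upwards closed dependencies. Then for every formula φ of FO(=(·), D) (with constancy atoms): if M ⊨_X φ then there exists Y ⊆ X with |Y| ≤ ht(φ) such that M ⊨_Y φ, where constancy atoms contribute 0 to the height ht(φ). -/
/-- A dependency `D` of arity `n` is `κ`-bounded. -/
def BoundedBy (n : ℕ) (D : ∀ M : Type, Set (Fin n → M) → Prop) (κ : Cardinal) : Prop :=
  ∀ (M : Type) (X : Team M) (xs : Fin n → ℕ), D M (X.rel xs) →
    ∃ Y ⊆ X, Cardinal.mk Y ≤ κ ∧ D M (Y.rel xs)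

/-- The height of a formula, given a bounding cardinal for each dependency. -/
def TForm.ht {σ : Type} {ar : σ → ℕ} {δ : Type} {dar : δ → ℕ} (κ : δ → Cardinal) :
    TForm σ ar δ dar → Cardinal
  | .dep d _ => κ d
  | .and φ ψ => φ.ht κ + ψ.ht κ
  | .or φ ψ => φ.ht κ + ψ.ht κ
  | .ex _ φ => φ.ht κ
  | .all _ φ => φ.ht κ
  | _ => 0

/-- If every element of `Y'` is related to some element of `X`, then at most `#Y'` elements of `X`
suffice to witness this. -/
theorem exists_subset_mk_le_of_forall_exists {α : Type} {X Y' : Set α} {R : α → α → Prop}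
    (h : ∀ s' ∈ Y', ∃ s ∈ X, R s s') :
    ∃ Y ⊆ X, Cardinal.mk Y ≤ Cardinal.mk Y' ∧ ∀ s' ∈ Y', ∃ s ∈ Y, R s s' := by
  choose f hfX hfR using h
  refine ⟨Set.range fun s' : Y' => f s' s'.2, ?_, Cardinal.mk_range_le, ?_⟩
  · rintro _ ⟨s', rfl⟩
    exact hfX _ _
  · exact fun s' hs' => ⟨_, ⟨⟨s', hs'⟩, rfl⟩, hfR s' hs'⟩

/-- If each dependency atom, in every team satisfying it, has a subteam of bounded size all of whose
extensions inside the team satisfy it, then so does every formula, with bound its height. -/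
theorem exists_small_core {σ : Type} {ar : σ → ℕ} {δ : Type} {dar : δ → ℕ}
    (DI : DepFam δ dar) (κ : δ → Cardinal) {M : Type} (RI : ∀ r : σ, Set (Fin (ar r) → M))
    (hdep : ∀ (d : δ) (xs : Fin (dar d) → ℕ) (X : Team M), DI d M (X.rel xs) →
      ∃ Y ⊆ X, Cardinal.mk Y ≤ κ d ∧ ∀ Z, Y ⊆ Z → Z ⊆ X → DI d M (Z.rel xs))
    (φ : TForm σ ar δ dar) (X : Team M) (h : tsat RI DI φ X) :
    ∃ Y ⊆ X, Cardinal.mk Y ≤ φ.ht κ ∧ ∀ Z, Y ⊆ Z → Z ⊆ X → tsat RI DI φ Z := by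
  induction φ generalizing X with
  | rel | nrel | eq | neq =>
    exact ⟨∅, Set.empty_subset _, by simp, fun Z _ hZX s hs => h s (hZX hs)⟩
  | dep d xs => exact hdep d xs X h
  | and φ ψ ihφ ihψ =>
    obtain ⟨A, hAX, hA, hφ⟩ := ihφ X h.1
    obtain ⟨B, hBX, hB, hψ⟩ := ihψ X h.2
    refine ⟨A ∪ B, Set.union_subset hAX hBX,
      (Cardinal.mk_union_le A B).trans (add_le_add hA hB), fun Z hZ hZX => ?_⟩
    rw [Set.union_subset_iff] at hZ
    exact ⟨hφ Z hZ.1 hZX, hψ Z hZ.2 hZX⟩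
  | or φ ψ ihφ ihψ =>
    obtain ⟨U, V, rfl, hU, hV⟩ := h
    obtain ⟨A, hAU, hA, hφ⟩ := ihφ U hU
    obtain ⟨B, hBV, hB, hψ⟩ := ihψ V hV
    refine ⟨A ∪ B, Set.union_subset_union hAU hBV,
      (Cardinal.mk_union_le A B).trans (add_le_add hA hB), fun Z hZ hZX => ?_⟩
    rw [Set.union_subset_iff] at hZ
    refine ⟨Z ∩ U, Z ∩ V, ?_, hφ _ (Set.subset_inter hZ.1 hAU) Set.inter_subset_right,
      hψ _ (Set.subset_inter hZ.2 hBV) Set.inter_subset_right⟩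
    rw [← Set.inter_union_distrib_left, Set.inter_eq_left.mpr hZX]
  | ex v φ ih =>
    obtain ⟨H, hH, h⟩ := h
    obtain ⟨Y', hY'X, hY', hφ⟩ := ih _ h
    obtain ⟨Y, hYX, hY, hYY'⟩ := exists_subset_mk_le_of_forall_exists hY'X
    refine ⟨Y, hYX, hY.trans hY', fun Z hYZ hZX =>
      ⟨H, fun s hs => hH s (hZX hs), hφ _ (fun s' hs' => ?_) ?_⟩⟩
    · obtain ⟨s, hs, hR⟩ := hYY' s' hs'
      exact ⟨s, hYZ hs, hR⟩
    · rintro s' ⟨s, hs, hR⟩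
      exact ⟨s, hZX hs, hR⟩
  | all v φ ih =>
    obtain ⟨Y', hY'X, hY', hφ⟩ := ih _ h
    obtain ⟨Y, hYX, hY, hYY'⟩ := exists_subset_mk_le_of_forall_exists hY'X
    refine ⟨Y, hYX, hY.trans hY', fun Z hYZ hZX => hφ _ (fun s' hs' => ?_) ?_⟩
    · obtain ⟨s, hs, hR⟩ := hYY' s' hs'
      exact ⟨s, hYZ hs, hR⟩
    · rintro s' ⟨s, hs, hR⟩
      exact ⟨s, hZX hs, hR⟩

theorem Team.rel_mono {M : Type} {X Y : Team M} (h : X ⊆ Y) {k : ℕ} (xs : Fin k → ℕ) :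
    X.rel xs ⊆ Y.rel xs := by
  rintro t ⟨s, hs, rfl⟩
  exact ⟨s, h hs, rfl⟩

/-- **Boundedness preservation with constancy atoms.**  For a family `D` of
bounded upwards closed dependencies, every team satisfying a formula of
`FO(=(·), D)` (dependency atoms indexed by `δ ⊕ ℕ`, with `.inr m` the constancy
atom of arity `m`, contributing `0` to the height) has a subteam of cardinality
at most `ht(φ)` satisfying it. -/
theorem boundedness_const {σ : Type} {ar : σ → ℕ} {δ : Type} {dar : δ → ℕ}
    (DI : DepFam δ dar) (hup : UpClosed DI) (κ : δ → Cardinal)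
    (hκ : ∀ d : δ, IsLeast {c : Cardinal | BoundedBy (dar d) (DI d) c} (κ d))
    {M : Type} (RI : ∀ r : σ, Set (Fin (ar r) → M))
    (φ : TForm σ ar (δ ⊕ ℕ) (Sum.elim dar id)) (X : Team M)
    (h : tsat RI (fun d => match d with | .inl d => DI d | .inr n => ConstD n) φ X) :
    ∃ Y ⊆ X, Cardinal.mk Y ≤ φ.ht (Sum.elim κ fun _ => 0) ∧
      tsat RI (fun d => match d with | .inl d => DI d | .inr n => ConstD n) φ Y := by
  suffices hcore : ∃ Y ⊆ X, Cardinal.mk Y ≤ φ.ht (Sum.elim κ fun _ => 0) ∧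
      ∀ Z, Y ⊆ Z → Z ⊆ X →
        tsat RI (fun d => match d with | .inl d => DI d | .inr n => ConstD n) φ Z by
    obtain ⟨Y, hYX, hY, hφ⟩ := hcore
    exact ⟨Y, hYX, hY, hφ Y subset_rfl hYX⟩
  refine exists_small_core _ _ RI (fun d xs X hX => ?_) φ X h
  cases d with
  | inl d =>
    obtain ⟨Y, hYX, hY, hD⟩ := (hκ d).1 M X xs hX
    exact ⟨Y, hYX, hY, fun Z hYZ _ => hup d M _ _ (Team.rel_mono hYZ xs) hD⟩
  | inr n =>
    exact ⟨∅, Set.empty_subset _, by simp, fun Z _ hZX t ht t' ht' =>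
      hX t (Team.rel_mono hZX xs ht) t' (Team.rel_mono hZX xs ht')⟩
end

section
/- Let D be a family of bounded upwards closed dependencies. Then the totality atom All(x) (M ⊨_X All(x) iff X(x) = dom(M)) is not definable in FO(=(·), D): there is no formula φ(x) of FO(=(·), D) such that M ⊨_X φ(x) iff X(x) = dom(M) for all models M and teams X. -/
/-- The bound `κ` works for `φ` over every model: each satisfying team `X` has a subteam `Y` of
size at most `κ` such that every team between `Y` and `X` satisfies `φ`. -/
def TForm.BoundedBelow {σ : Type} {ar : σ → ℕ} {δ : Type} {dar : δ → ℕ}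
    (DI : DepFam δ dar) (φ : TForm σ ar δ dar) (κ : Cardinal) : Prop :=
  ∀ (M : Type) (RI : ∀ r : σ, Set (Fin (ar r) → M)) (X : Team M), tsat RI DI φ X →
    ∃ Y ⊆ X, Cardinal.mk Y ≤ κ ∧ ∀ Z, Y ⊆ Z → Z ⊆ X → tsat RI DI φ Z

theorem Team.mk_rel_le {M : Type} (X : Team M) {k : ℕ} (xs : Fin k → ℕ) :
    Cardinal.mk (X.rel xs) ≤ Cardinal.mk X := by
  have h : X.rel xs = (fun s : ℕ → M => fun i => s (xs i)) '' X := by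
    ext t
    simp [Team.rel, eq_comm]
  rw [h]
  exact Cardinal.mk_image_le

/-- Every small set of assignments supplemented from `X` is supplemented from a small part
of `X`. -/
theorem Team.exists_small_support {M : Type} {X Y : Team M} (H : (ℕ → M) → Set M) (v : ℕ)
    (hY : Y ⊆ {s' | ∃ s ∈ X, ∃ m ∈ H s, s' = Function.update s v m}) :
    ∃ W ⊆ X, Cardinal.mk W ≤ Cardinal.mk Y ∧
      Y ⊆ {s' | ∃ s ∈ W, ∃ m ∈ H s, s' = Function.update s v m} := by
  choose f hfX hf using fun s' : Y => hY s'.2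
  refine ⟨Set.range f, ?_, Cardinal.mk_range_le, fun s' hs' => ⟨f ⟨s', hs'⟩, ⟨_, rfl⟩, hf ⟨s', hs'⟩⟩⟩
  rintro _ ⟨s', rfl⟩
  exact hfX s'

/-- If each dependency is either downwards closed, or bounded and upwards closed, then every
formula has the boundedness property. -/
theorem TForm.exists_boundedBelow {σ : Type} {ar : σ → ℕ} {δ : Type} {dar : δ → ℕ}
    (DI : DepFam δ dar)
    (hDI : ∀ d : δ, (∀ (M : Type) (R S : Set (Fin (dar d) → M)), R ⊆ S → DI d M S → DI d M R) ∨
      ((∀ (M : Type) (R S : Set (Fin (dar d) → M)), R ⊆ S → DI d M R → DI d M S) ∧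
        ∃ κ : Cardinal, BoundedBy (dar d) (DI d) κ))
    (φ : TForm σ ar δ dar) : ∃ κ : Cardinal, φ.BoundedBelow DI κ := by
  induction φ with
  | rel | nrel | eq | neq =>
    exact ⟨0, fun M RI X h => ⟨∅, Set.empty_subset X, by simp, fun Z _ hZ s hs => h s (hZ hs)⟩⟩
  | dep d xs =>
    rcases hDI d with hd | ⟨hu, κ, hκ⟩
    · exact ⟨0, fun M RI X h => ⟨∅, Set.empty_subset X, by simp,
        fun Z _ hZ => hd M _ _ (Team.rel_mono hZ xs) h⟩⟩
    · refine ⟨κ, fun M RI X h => ?_⟩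
      obtain ⟨Y, hYX, hcard, hY⟩ := hκ M X xs h
      exact ⟨Y, hYX, hcard, fun Z hZ _ => hu M _ _ (Team.rel_mono hZ xs) hY⟩
  | and φ ψ ihφ ihψ =>
    obtain ⟨κ, hκ⟩ := ihφ
    obtain ⟨μ, hμ⟩ := ihψ
    refine ⟨κ + μ, fun M RI X h => ?_⟩
    obtain ⟨A, hAX, hAc, hA⟩ := hκ M RI X h.1
    obtain ⟨B, hBX, hBc, hB⟩ := hμ M RI X h.2
    exact ⟨A ∪ B, Set.union_subset hAX hBX,
      (Cardinal.mk_union_le A B).trans (add_le_add hAc hBc), fun Z hZ hZX =>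
        ⟨hA Z (Set.subset_union_left.trans hZ) hZX, hB Z (Set.subset_union_right.trans hZ) hZX⟩⟩
  | or φ ψ ihφ ihψ =>
    obtain ⟨κ, hκ⟩ := ihφ
    obtain ⟨μ, hμ⟩ := ihψ
    refine ⟨κ + μ, fun M RI X h => ?_⟩
    obtain ⟨P, Q, rfl, hP, hQ⟩ := h
    obtain ⟨A, hAP, hAc, hA⟩ := hκ M RI P hP
    obtain ⟨B, hBQ, hBc, hB⟩ := hμ M RI Q hQ
    refine ⟨A ∪ B, Set.union_subset_union hAP hBQ,
      (Cardinal.mk_union_le A B).trans (add_le_add hAc hBc), fun Z hZ hZX =>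
        ⟨Z ∩ P, Z ∩ Q, ?_, hA _ ?_ Set.inter_subset_right, hB _ ?_ Set.inter_subset_right⟩⟩
    · rw [← Set.inter_union_distrib_left, Set.inter_eq_left.2 hZX]
    · exact Set.subset_inter (Set.subset_union_left.trans hZ) hAP
    · exact Set.subset_inter (Set.subset_union_right.trans hZ) hBQ
  | ex v φ ih =>
    obtain ⟨κ, hκ⟩ := ih
    refine ⟨κ, fun M RI X h => ?_⟩
    obtain ⟨H, hH, hsat⟩ := h
    obtain ⟨Y, hYX, hYc, hY⟩ := hκ M RI _ hsat
    obtain ⟨W, hWX, hWc, hW⟩ := Team.exists_small_support H v hYX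
    refine ⟨W, hWX, hWc.trans hYc, fun Z hWZ hZX => ⟨H, fun s hs => hH s (hZX hs), hY _ ?_ ?_⟩⟩
    · exact hW.trans fun _ ⟨s, hs, h⟩ => ⟨s, hWZ hs, h⟩
    · exact fun _ ⟨s, hs, h⟩ => ⟨s, hZX hs, h⟩
  | all v φ ih =>
    obtain ⟨κ, hκ⟩ := ih
    refine ⟨κ, fun M RI X h => ?_⟩
    obtain ⟨Y, hYX, hYc, hY⟩ := hκ M RI _ h
    obtain ⟨W, hWX, hWc, hW⟩ := Team.exists_small_support (X := X) (fun _ => Set.univ) v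
      (hYX.trans fun _ ⟨s, hs, m, h⟩ => ⟨s, hs, m, Set.mem_univ m, h⟩)
    refine ⟨W, hWX, hWc.trans hYc, fun Z hWZ hZX => hY _ ?_ ?_⟩
    · exact hW.trans fun _ ⟨s, hs, m, _, h⟩ => ⟨s, hWZ hs, m, h⟩
    · exact fun _ ⟨s, hs, h⟩ => ⟨s, hZX hs, h⟩

/-- **Non-definability of totality.**  If every dependency in `D` is bounded and
upwards closed, then no formula `φ(x)` of `FO(=(·), D)` (dependency atoms
indexed by `δ ⊕ ℕ`, with `.inr m` the constancy atom of arity `m`) defines the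
totality atom `All(x)`, i.e. satisfies `M ⊨_X φ(x)` iff `X(x) = dom(M)` for
all models `M` and teams `X`. -/
theorem totality_not_definable {σ : Type} {ar : σ → ℕ} {δ : Type} {dar : δ → ℕ}
    (DI : DepFam δ dar) (hup : UpClosed DI)
    (hbd : ∀ d : δ, ∃ κ : Cardinal, BoundedBy (dar d) (DI d) κ) :
    ¬ ∃ (x : ℕ) (φ : TForm σ ar (δ ⊕ ℕ) (Sum.elim dar id)),
        ∀ (M : Type) (RI : ∀ r : σ, Set (Fin (ar r) → M)) (X : Team M),
          tsat RI (fun d => match d with | .inl d => DI d | .inr n => ConstD n) φ X ↔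
            X.rel (fun _ : Fin 1 => x) = Set.univ := by
  rintro ⟨x, φ, hφ⟩
  obtain ⟨κ, hκ⟩ := TForm.exists_boundedBelow
    (fun d => match d with | .inl d => DI d | .inr n => ConstD n)
    (by
      rintro (d | n)
      · exact Or.inr ⟨hup d, hbd d⟩
      · exact Or.inl fun M R S hRS h t ht t' ht' => h t (hRS ht) t' (hRS ht')) φ
  have hfull : Team.rel (Set.univ : Team (Set κ.out)) (fun _ : Fin 1 => x) = Set.univ :=
    Set.eq_univ_of_forall fun t =>
      ⟨fun _ => t 0, Set.mem_univ _, funext fun i => congrArg t (Subsingleton.elim i 0)⟩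
  obtain ⟨Y, -, hYc, hY⟩ := hκ _ (fun _ => ∅) Set.univ ((hφ _ _ _).2 hfull)
  have hYfull := (hφ _ _ _).1 (hY Y subset_rfl (Set.subset_univ Y))
  have hle := (Team.mk_rel_le Y (fun _ : Fin 1 => x)).trans hYc
  rw [hYfull, Cardinal.mk_univ, Cardinal.mk_congr (Equiv.funUnique (Fin 1) (Set κ.out)),
    Cardinal.mk_set, Cardinal.mk_out] at hle
  exact (Cardinal.cantor κ).not_ge hle
end
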